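/- arXiv:2111.13374 — 2 statements merged into one kernel-verified Lean document; each statement's English description precedes it below -/
import Mathlib

section
/- Let n ≥ 2, let h and h̃ be real symmetric n×n matrices, let ℓ ∈ ℝⁿ, and suppose there exists y ∈ ℝⁿ, y ≠ 0, with h·y = 0 and h̃·y = 0. Set g = h + ℓℓᵀ and let c be a real number. For α ∈ {0, 1, …, n} let δ_α denote the coefficient of Λ^α in the polynomial Λ ↦ det(c·h̃ + Λ·g). Then δ_0 = 0, and for every α ∈ {1, …, n}: δ_α = (c^{n−α}/((α−1)!(n−α)!)) · Σ_{σ₁,σ₂ ∈ S_n} sgn(σ₁)sgn(σ₂) · h_{σ₁(1)σ₂(1)} ⋯ h_{σ₁(α−1)σ₂(α−1)} · h̃_{σ₁(α)σ₂(α)} ⋯ h̃_{σ₁(n−1)σ₂(n−1)} · ℓ_{σ₁(n)} ℓ_{σ₂(n)}. -/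
open Matrix Polynomial Equiv

/-- The polarization of the determinant, up to the factor `n!`. -/
def mixedDet {ι R : Type*} [Fintype ι] [DecidableEq ι] [CommRing R]
    (M : ι → Matrix ι ι R) : R :=
  ∑ σ₁ : Perm ι, ∑ σ₂ : Perm ι,
    ((Perm.sign σ₁ : ℤ) : R) * ((Perm.sign σ₂ : ℤ) : R) * ∏ i, M i (σ₁ i) (σ₂ i)

section MixedDet

variable {ι R : Type*} [Fintype ι] [DecidableEq ι] [CommRing R]

theorem mixedDet_comp_perm (M : ι → Matrix ι ι R) (τ : Perm ι) :
    mixedDet (fun i => M (τ i)) = mixedDet M := by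
  unfold mixedDet
  refine Fintype.sum_equiv (Equiv.mulRight τ⁻¹) _ _ fun σ₁ => ?_
  refine Fintype.sum_equiv (Equiv.mulRight τ⁻¹) _ _ fun σ₂ => ?_
  have hs : ((Perm.sign τ : ℤ) : R) * ((Perm.sign τ : ℤ) : R) = 1 := by
    norm_cast
    simp
  have hp : ∏ i, M i ((σ₁ * τ⁻¹) i) ((σ₂ * τ⁻¹) i) = ∏ i, M (τ i) (σ₁ i) (σ₂ i) := by
    rw [← Equiv.prod_comp τ]
    simp
  simp only [Equiv.coe_mulRight, hp, Perm.sign_mul, Perm.sign_inv, Units.val_mul, Int.cast_mul]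
  linear_combination (-(((Perm.sign σ₁ : ℤ) : R) * ((Perm.sign σ₂ : ℤ) : R) *
    ∏ i, M (τ i) (σ₁ i) (σ₂ i))) * hs

theorem mixedDet_const (A : Matrix ι ι R) :
    mixedDet (fun _ => A) = ((Fintype.card ι).factorial : R) * A.det := by
  have key : ∀ σ₂ : Perm ι, ∑ σ₁ : Perm ι,
      ((Perm.sign σ₁ : ℤ) : R) * ((Perm.sign σ₂ : ℤ) : R) * ∏ i, A (σ₁ i) (σ₂ i) = A.det := by
    intro σ₂
    have hs : ((Perm.sign σ₂ : ℤ) : R) * ((Perm.sign σ₂ : ℤ) : R) = 1 := by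
      norm_cast
      simp
    have h := Matrix.det_permute' σ₂ A
    rw [det_apply'] at h
    simp only [submatrix_apply, id] at h
    calc _ = ((Perm.sign σ₂ : ℤ) : R) *
          ∑ σ₁ : Perm ι, ((Perm.sign σ₁ : ℤ) : R) * ∏ i, A (σ₁ i) (σ₂ i) := by
          rw [Finset.mul_sum]
          exact Finset.sum_congr rfl fun _ _ => by ring
      _ = A.det := by rw [h, ← mul_assoc, hs, one_mul]
  unfold mixedDet
  rw [Finset.sum_comm, Finset.sum_congr rfl fun σ₂ _ => key σ₂]
  simp [Fintype.card_perm]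

theorem mixedDet_smul (a : ι → R) (M : ι → Matrix ι ι R) :
    mixedDet (fun i => a i • M i) = (∏ i, a i) * mixedDet M := by
  simp only [mixedDet, Matrix.smul_apply, smul_eq_mul, Finset.prod_mul_distrib, Finset.mul_sum]
  exact Finset.sum_congr rfl fun _ _ => Finset.sum_congr rfl fun _ _ => by ring

theorem RingHom.map_mixedDet {S : Type*} [CommRing S] (f : R →+* S) (M : ι → Matrix ι ι R) :
    f (mixedDet M) = mixedDet (fun i => (M i).map f) := by
  simp [mixedDet]

theorem mixedDet_ite_add (t : Finset ι) (A B N : ι → Matrix ι ι R) :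
    mixedDet (fun i => if i ∈ t then A i + B i else N i) =
      ∑ s ∈ t.powerset, mixedDet (fun i => if i ∈ s then A i else if i ∈ t then B i else N i) := by
  have key : ∀ σ₁ σ₂ : Perm ι,
      ∏ i, (if i ∈ t then A i + B i else N i) (σ₁ i) (σ₂ i) =
      ∑ s ∈ t.powerset,
        ∏ i, (if i ∈ s then A i else if i ∈ t then B i else N i) (σ₁ i) (σ₂ i) := by
    intro σ₁ σ₂
    rw [← Finset.prod_mul_prod_compl t, Finset.prod_congr rfl (g := fun i =>
      A i (σ₁ i) (σ₂ i) + B i (σ₁ i) (σ₂ i)) (fun i hi => by simp [hi]), Finset.prod_add,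
      Finset.sum_mul]
    refine Finset.sum_congr rfl fun s hs => ?_
    rw [Finset.mem_powerset] at hs
    rw [← Finset.prod_mul_prod_compl t, ← Finset.prod_sdiff hs, mul_comm (∏ i ∈ s, _)]
    congr 1
    · congr 1
      · refine Finset.prod_congr rfl fun i hi => ?_
        rw [Finset.mem_sdiff] at hi
        simp [hi.1, hi.2]
      · exact Finset.prod_congr rfl fun i hi => by simp [hi]
    · refine Finset.prod_congr rfl fun i hi => ?_
      rw [Finset.mem_compl] at hi
      have his : i ∉ s := fun h => hi (hs h)
      simp [hi, his]
  simp only [mixedDet, key, Finset.mul_sum]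
  rw [Finset.sum_comm' (s := t.powerset) (t := fun _ => Finset.univ) (s' := fun _ => t.powerset)
    (t' := Finset.univ) (by simp)]
  exact Finset.sum_congr rfl fun _ _ => Finset.sum_comm

theorem mixedDet_eq_zero_of_rank_one (M : ι → Matrix ι ι R) (u v : ι → R) {i j : ι} (hij : i ≠ j)
    (hi : M i = vecMulVec u v) (hj : M j = vecMulVec u v) : mixedDet M = 0 := by
  unfold mixedDet
  refine Finset.sum_eq_zero fun σ₁ _ => ?_
  refine Finset.sum_involution (fun σ₂ _ => σ₂ * swap i j) ?_ ?_ (by simp) (by simp)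
  · intro σ₂ _
    have hp : ∏ k, M k (σ₁ k) ((σ₂ * swap i j) k) = ∏ k, M k (σ₁ k) (σ₂ k) := by
      rw [← Finset.prod_mul_prod_compl {i, j}, ← Finset.prod_mul_prod_compl {i, j} fun k =>
        M k (σ₁ k) (σ₂ k), Finset.prod_pair hij, Finset.prod_pair hij]
      congr 1
      · simp only [hi, hj, vecMulVec_apply, Perm.mul_apply, swap_apply_left, swap_apply_right]
        ring
      · refine Finset.prod_congr rfl fun k hk => ?_
        simp only [Finset.mem_compl, Finset.mem_insert, Finset.mem_singleton, not_or] at hk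
        rw [Perm.mul_apply, swap_apply_of_ne_of_ne hk.1 hk.2]
    rw [hp, Perm.sign_mul, Perm.sign_swap hij]
    push_cast
    ring
  · intro σ₂ _ _ h
    exact hij (swap_eq_one_iff.mp (mul_eq_left.mp h))

end MixedDet

theorem exists_perm_comp_eq_of_card_fiber_eq {ι κ : Type*} [Fintype ι] [DecidableEq κ]
    (f g : ι → κ) (h : ∀ k, Fintype.card {i // g i = k} = Fintype.card {i // f i = k}) :
    ∃ τ : Perm ι, ∀ i, f (τ i) = g i :=
  ⟨ofFiberEquiv fun k => Fintype.equivOfCardEq (h k), fun i => ofFiberEquiv_map _ i⟩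

theorem mixedDet_ite_add_const {R : Type*} [CommRing R] {n N : ℕ} (hN : N ≤ n)
    (A B E : Matrix (Fin n) (Fin n) R) :
    mixedDet (fun i : Fin n => if (i : ℕ) < N then A + B else E) =
      ∑ k ∈ Finset.range (N + 1), (N.choose k : R) *
        mixedDet (fun i : Fin n => if (i : ℕ) < k then A else if (i : ℕ) < N then B else E) := by
  set t : Finset (Fin n) := {i | (i : ℕ) < N} with ht
  have hcard : ∀ m ≤ n, Finset.card {i : Fin n | (i : ℕ) < m} = m := fun m hm => by
    rw [Fin.card_filter_val_lt, min_eq_right hm]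
  have h := mixedDet_ite_add t (fun _ => A) (fun _ => B) (fun _ => E)
  have hs : ∀ s ∈ t.powerset,
      mixedDet (fun i => if i ∈ s then A else if i ∈ t then B else E) =
      mixedDet (fun i : Fin n => if (i : ℕ) < s.card then A else if (i : ℕ) < N then B else E) := by
    intro s hs
    rw [Finset.mem_powerset] at hs
    have hsN : s.card ≤ N := (Finset.card_le_card hs).trans_eq (hcard N hN)
    let label (s : Finset (Fin n)) (i : Fin n) : Fin 3 :=
      if i ∈ s then 0 else if i ∈ t then 1 else 2
    have hlabel : ∀ s ⊆ t, ∀ k, Fintype.card {i // label s i = k} =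
        ![s.card, N - s.card, n - N] k := by
      intro s hs k
      rw [Fintype.card_subtype]
      fin_cases k
      · simp only [label]
        congr 1
        ext i
        simp
        split_ifs <;> simp_all
      · have : ({i | label s i = 1} : Finset (Fin n)) = t \ s := by
          ext i
          simp only [label, Finset.mem_filter, Finset.mem_sdiff]
          split_ifs <;> simp_all
        simpa [this, Finset.card_sdiff_of_subset hs] using congrArg (· - s.card) (hcard N hN)
      · have : ({i | label s i = 2} : Finset (Fin n)) = tᶜ := by
          ext i
          have := @hs i
          simp only [label, Finset.mem_filter, Finset.mem_compl]
          split_ifs <;> simp_all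
        simpa [this, Finset.card_compl] using congrArg (n - ·) (hcard N hN)
    set s' : Finset (Fin n) := {i | (i : ℕ) < s.card}
    have hs' : s' ⊆ t := fun i hi => by
      simp only [s', ht, Finset.mem_filter_univ] at hi ⊢
      omega
    obtain ⟨τ, hτ⟩ := exists_perm_comp_eq_of_card_fiber_eq (label s) (label s') fun k => by
      rw [hlabel s hs, hlabel s' hs', hcard _ (hsN.trans hN)]
    have hM : ∀ s i, (if i ∈ s then A else if i ∈ t then B else E) = ![A, B, E] (label s i) := by
      intro s i
      simp only [label]
      split_ifs <;> rfl
    have hM' : (fun i : Fin n => if (i : ℕ) < s.card then A else if (i : ℕ) < N then B else E) =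
        fun i => ![A, B, E] (label s' i) := by
      ext1 i
      rw [← hM]
      simp [s', ht]
    simp only [hM', hM, ← hτ]
    exact (mixedDet_comp_perm (fun i => ![A, B, E] (label s i)) τ).symm
  rw [Finset.sum_congr rfl hs, Finset.sum_powerset_apply_card (fun k => mixedDet
    (fun i : Fin n => if (i : ℕ) < k then A else if (i : ℕ) < N then B else E)), hcard N hN] at h
  simpa [ht] using h

/-- Matrix determinant lemma for a singular matrix, in terms of `mixedDet`. -/
theorem factorial_mul_det_add_vecMulVec {R : Type*} [CommRing R] {n : ℕ}
    (B : Matrix (Fin (n + 1)) (Fin (n + 1)) R) (u v : Fin (n + 1) → R) (hB : B.det = 0) :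
    ((n + 1).factorial : R) * (B + vecMulVec u v).det =
      (n + 1) * mixedDet (fun i : Fin (n + 1) => if (i : ℕ) < n then B else vecMulVec u v) := by
  have h := mixedDet_ite_add_const le_rfl B (vecMulVec u v) 0 (n := n + 1)
  simp only [Fin.is_lt, if_true, mixedDet_const, Fintype.card_fin] at h
  rw [h, Finset.sum_range_succ, Finset.sum_range_succ, Finset.sum_eq_zero]
  · have hB' : mixedDet (fun i : Fin (n + 1) => if (i : ℕ) < n + 1 then B else vecMulVec u v) =
        0 := by
      simp only [Fin.is_lt, if_true, mixedDet_const, hB, mul_zero]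
    rw [hB']
    simp
  · intro k hk
    rw [Finset.mem_range] at hk
    rw [mixedDet_eq_zero_of_rank_one _ u v (i := ⟨k, by omega⟩) (j := Fin.last n), mul_zero]
    · exact Fin.ne_of_lt hk
    · simp
    · simp [hk.le]

theorem Fin.prod_ite_lt_lt {M : Type*} [CommMonoid M] {n N k : ℕ} (hN : N ≤ n) (hk : k ≤ N)
    (a b : M) :
    ∏ i : Fin n, (if (i : ℕ) < k then a else if (i : ℕ) < N then b else 1) =
      a ^ k * b ^ (N - k) := by
  obtain ⟨p, rfl⟩ := Nat.exists_eq_add_of_le hk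
  obtain ⟨q, rfl⟩ := Nat.exists_eq_add_of_le hN
  rw [Fin.prod_univ_eq_prod_range (fun i => if i < k then a else if i < k + p then b else 1),
    Finset.prod_range_add, Finset.prod_range_add]
  rw [Finset.prod_congr rfl (g := fun _ => a) fun i hi => if_pos (Finset.mem_range.mp hi)]
  rw [Finset.prod_congr rfl (s₁ := Finset.range p) (g := fun _ => b) fun i hi => by
    simp [Finset.mem_range.mp hi]]
  simp [add_assoc]

theorem coeff_det_smul_add_X_smul {n : ℕ} (H K : Matrix (Fin (n + 1)) (Fin (n + 1)) ℝ)
    (u v : Fin (n + 1) → ℝ) (c : ℝ)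
    (hdet : ((X : ℝ[X]) • H.map C + C c • K.map C).det = 0) (k : ℕ) (hk : k ≤ n) :
    ((C c • K.map C + (X : ℝ[X]) • (H + vecMulVec u v).map C).det).coeff (k + 1) =
      c ^ (n - k) / (k.factorial * (n - k).factorial) *
        mixedDet (fun i : Fin (n + 1) =>
          if (i : ℕ) < k then H else if (i : ℕ) < n then K else vecMulVec u v) := by
  let D (k : ℕ) : ℝ := mixedDet (fun i : Fin (n + 1) =>
    if (i : ℕ) < k then H else if (i : ℕ) < n then K else vecMulVec u v)
  let E : Matrix (Fin (n + 1)) (Fin (n + 1)) ℝ[X] :=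
    vecMulVec ((X : ℝ[X]) • (C ∘ u : _ → ℝ[X])) (C ∘ v)
  have hsplit : C c • K.map C + (X : ℝ[X]) • (H + vecMulVec u v).map C =
      ((X : ℝ[X]) • H.map C + C c • K.map C) + E := by
    ext1 i j
    simp [E, vecMulVec_apply]
    ring
  have hterm : ∀ k ∈ Finset.range (n + 1), (n.choose k : ℝ[X]) *
      mixedDet (fun i : Fin (n + 1) =>
        if (i : ℕ) < k then (X : ℝ[X]) • H.map C else if (i : ℕ) < n then C c • K.map C else E) =
      C (n.choose k * c ^ (n - k) * D k) * X ^ (k + 1) := by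
    intro k hk
    have hk : k ≤ n := Finset.mem_range_succ_iff.mp hk
    have hM : (fun i : Fin (n + 1) =>
        if (i : ℕ) < k then (X : ℝ[X]) • H.map (C : ℝ →+* ℝ[X]) else
          if (i : ℕ) < n then C c • K.map C else E) =
        fun i : Fin (n + 1) =>
          ((if (i : ℕ) < k then X else if (i : ℕ) < n then C c else 1) *
            (if (i : ℕ) < n then 1 else X)) •
          (if (i : ℕ) < k then H else if (i : ℕ) < n then K else vecMulVec u v).map
            (C : ℝ →+* ℝ[X]) := by
      ext1 i
      have : (i : ℕ) < k → (i : ℕ) < n := fun h => h.trans_le hk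
      split_ifs <;> first | omega | skip
      · simp
      · simp
      · ext1 a b
        simp [E, vecMulVec_apply]
    have hX : ∏ i : Fin (n + 1), (if (i : ℕ) < n then 1 else X : ℝ[X]) = X := by
      rw [Fin.prod_univ_castSucc]
      simp
    rw [hM, mixedDet_smul, Finset.prod_mul_distrib, Fin.prod_ite_lt_lt n.le_succ hk, hX,
      ← RingHom.map_mixedDet]
    simp only [D, C_mul, C_pow, map_natCast]
    ring
  have h := factorial_mul_det_add_vecMulVec _ ((X : ℝ[X]) • (C ∘ u : _ → ℝ[X])) (C ∘ v) hdet
  rw [mixedDet_ite_add_const n.le_succ, Finset.sum_congr rfl hterm] at h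
  have h' := congrArg (fun p => coeff p (k + 1)) h
  have hcast : (n + 1 : ℝ[X]) = C (n + 1 : ℝ) := by simp
  have hcast' : ((n + 1).factorial : ℝ[X]) = C ((n + 1).factorial : ℝ) := by simp
  simp only [hcast, hcast', coeff_C_mul, finsetSum_coeff, coeff_X_pow] at h'
  rw [Finset.sum_eq_single k (fun b _ hb => by simp [hb.symm]) (by simp; omega), if_pos rfl] at h'
  rw [hsplit]
  have hchoose : (n.choose k * k.factorial * (n - k).factorial : ℝ) = n.factorial := by
    exact_mod_cast Nat.choose_mul_factorial_mul_factorial hk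
  have h3 : (n.factorial : ℝ) ≠ 0 := by positivity
  have h4 : (n + 1 : ℝ) ≠ 0 := by positivity
  rw [Nat.factorial_succ] at h'
  push_cast at h'
  change _ = _ * D k
  rw [div_mul_eq_mul_div, eq_div_iff (by positivity)]
  apply mul_left_cancel₀ (mul_ne_zero h4 h3)
  linear_combination (k.factorial * (n - k).factorial : ℝ) * h' +
    (n + 1) * c ^ (n - k) * D k * hchoose

/-- explicit formula for the coefficients `δ_α` of the polynomial
`Λ ↦ det(c·h̃ + Λ·g)`, where `g = h + ℓℓᵀ` and `h`, `h̃` are symmetric matrices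
with a common nonzero kernel vector: `δ_0 = 0` and for `1 ≤ α ≤ n`,
`δ_α = (c^{n−α}/((α−1)!(n−α)!)) Σ_{σ₁,σ₂} sgn(σ₁)sgn(σ₂) ·
  h_{σ₁(1)σ₂(1)}⋯h_{σ₁(α−1)σ₂(α−1)} · h̃_{σ₁(α)σ₂(α)}⋯h̃_{σ₁(n−1)σ₂(n−1)} ·
  ℓ_{σ₁(n)}ℓ_{σ₂(n)}`. -/
theorem delta_coefficients_formula
    (n : ℕ) (hn : 2 ≤ n) (h ht : Matrix (Fin n) (Fin n) ℝ)
    (hsymm : h.IsSymm) (htsymm : ht.IsSymm)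
    (ℓ : Fin n → ℝ) (c : ℝ)
    (y : Fin n → ℝ) (hy : y ≠ 0) (hhy : h.mulVec y = 0) (hty : ht.mulVec y = 0)
    (g : Matrix (Fin n) (Fin n) ℝ)
    (hg : g = h + Matrix.of (fun i j => ℓ i * ℓ j))
    (δ : ℕ → ℝ)
    (hδ : ∀ α : ℕ, α ≤ n → δ α =
      (Matrix.det ((c • ht).map Polynomial.C +
        (Polynomial.X : Polynomial ℝ) • g.map Polynomial.C)).coeff α) :
    δ 0 = 0 ∧
    ∀ α : ℕ, 1 ≤ α → α ≤ n →
      δ α = c ^ (n - α) /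
          ((Nat.factorial (α - 1) : ℝ) * (Nat.factorial (n - α) : ℝ)) *
        ∑ σ₁ : Equiv.Perm (Fin n), ∑ σ₂ : Equiv.Perm (Fin n),
          ((Equiv.Perm.sign σ₁ : ℤ) : ℝ) * ((Equiv.Perm.sign σ₂ : ℤ) : ℝ) *
            ∏ i : Fin n,
              if (i : ℕ) < α - 1 then h (σ₁ i) (σ₂ i)
              else if (i : ℕ) < n - 1 then ht (σ₁ i) (σ₂ i)
              else ℓ (σ₁ i) * ℓ (σ₂ i) := by
  obtain ⟨n, rfl⟩ : ∃ m, n = m + 1 := ⟨n - 1, by omega⟩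
  have hmap : (c • ht).map C = C c • ht.map C := by
    ext1 i j
    simp
  constructor
  · have hdet : ht.det = 0 := exists_mulVec_eq_zero_iff.mp ⟨y, hy, hty⟩
    rw [hδ 0 (Nat.zero_le _), coeff_zero_eq_eval_zero, ← coe_evalRingHom, RingHom.map_det]
    have : (evalRingHom 0).mapMatrix ((c • ht).map C + (X : ℝ[X]) • g.map C) = c • ht := by
      ext1 i j
      simp
    rw [this, det_smul, hdet, mul_zero]
  · intro α hα hαn
    obtain ⟨k, rfl⟩ : ∃ k, α = k + 1 := ⟨α - 1, by omega⟩
    have hdet : ((X : ℝ[X]) • h.map C + C c • ht.map C).det = 0 := by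
      refine exists_mulVec_eq_zero_iff.mp ⟨C ∘ y, ?_, ?_⟩
      · exact fun h0 => hy (funext fun i => by simpa using congrFun h0 i)
      · have hC : ∀ M : Matrix (Fin (n + 1)) (Fin (n + 1)) ℝ, M *ᵥ y = 0 →
            M.map C *ᵥ (C ∘ y) = 0 := by
          intro M hM
          ext1 i
          rw [← RingHom.map_mulVec, hM]
          simp
        rw [add_mulVec, smul_mulVec, smul_mulVec, hC h hhy, hC ht hty]
        simp
    have hg' : g = h + vecMulVec ℓ ℓ := hg
    rw [hδ _ hαn, hmap, hg', coeff_det_smul_add_X_smul h ht ℓ ℓ c hdet k (by omega)]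
    simp only [mixedDet, Nat.add_sub_cancel, Nat.add_sub_add_right]
    congr 1
    refine Finset.sum_congr rfl fun σ₁ _ => Finset.sum_congr rfl fun σ₂ _ => ?_
    congr 1
    refine Finset.prod_congr rfl fun i _ => ?_
    split_ifs <;> simp [vecMulVec_apply]
end

section
/- Let n ≥ 2, let h̃ be a real symmetric n×n matrix with det h̃ = 0, and let ℓ ∈ ℝⁿ. Then (1/(n−1)!) · Σ_{σ₁,σ₂ ∈ S_n} sgn(σ₁)sgn(σ₂) · h̃_{σ₁(1)σ₂(1)} ⋯ h̃_{σ₁(n−1)σ₂(n−1)} · ℓ_{σ₁(n)} ℓ_{σ₂(n)} = det(h̃ + ℓℓᵀ). -/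
open Matrix Polynomial Equiv

open Finset in
/-- First-order expansion of the determinant under a rank-one perturbation. -/
theorem Matrix.det_add_vecMulVec_eq_sum {ι R : Type*} [Fintype ι] [DecidableEq ι] [CommRing R]
    (A : Matrix ι ι R) (u v : ι → R) :
    (A + vecMulVec u v).det = A.det + ∑ p, u p * (A.updateRow p v).det := by
  have hzero : ∀ s : Finset ι, 2 ≤ #s →
      det (of (s.piecewise (fun i => u i • v) A.row)) = 0 := by
    intro s hs
    obtain ⟨i, hi, j, hj, hij⟩ := one_lt_card.mp hs
    set B : Matrix ι ι R := of (s.piecewise (fun i => u i • v) A.row) with hB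
    have hrow : ∀ k ∈ s, ∀ l, B k l = u k * v l := fun k hk l => by simp [hB, hk]
    have hupdate : B = (B.updateRow i (u i • v)).updateRow j (u j • v) := by
      ext k l
      simp only [updateRow_apply, Pi.smul_apply, smul_eq_mul]
      split_ifs with hkj hki
      · rw [hkj, hrow j hj]
      · rw [hki, hrow i hi]
      · rfl
    rw [hupdate, det_updateRow_smul, updateRow_comm _ hij, det_updateRow_smul,
      det_zero_of_row_eq hij (by rw [updateRow_self, updateRow_ne hij.symm, updateRow_self]),
      mul_zero, mul_zero]
  have h := MultilinearMap.map_add_eq_map_add_linearDeriv_add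
    (detRowAlternating (n := ι) (R := R)).toMultilinearMap A.row (fun i => u i • v)
  have hsum : ∑ s with 2 ≤ #s, (detRowAlternating (n := ι) (R := R)).toMultilinearMap
      (s.piecewise (fun i => u i • v) A.row) = 0 :=
    sum_eq_zero fun s hs => hzero s (mem_filter.mp hs).2
  rw [hsum, add_zero, MultilinearMap.linearDeriv_apply] at h
  refine h.trans (congrArg (A.det + ·) (sum_congr rfl fun p _ => ?_))
  exact det_updateRow_smul A p (u p) v

/-- Each value is attained at a given point by `n!` permutations of `Fin (n + 1)`. -/
theorem Equiv.Perm.sum_apply_fin {R : Type*} [CommSemiring R] (n : ℕ) (f : Fin (n + 1) → R)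
    (a : Fin (n + 1)) :
    ∑ σ : Perm (Fin (n + 1)), f (σ a) = (n.factorial : R) * ∑ p, f p := by
  rw [← Equiv.sum_comp (Equiv.mulRight (swap 0 a)),
    ← Equiv.sum_comp Perm.decomposeFin.symm, Fintype.sum_prod_type]
  simp [Fintype.card_perm, Finset.mul_sum]

/-- Leibniz expansion of the determinant with the rows listed in the order given by `σ`. -/
theorem Matrix.sum_sign_mul_prod_eq_det {ι R : Type*} [Fintype ι] [DecidableEq ι] [CommRing R]
    (A : Matrix ι ι R) (σ : Perm ι) :
    ∑ τ : Perm ι, ((Perm.sign σ : ℤ) : R) * ((Perm.sign τ : ℤ) : R) * ∏ i, A (σ i) (τ i) =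
      A.det := by
  rw [← Equiv.sum_comp (Equiv.mulRight σ), ← det_transpose, det_apply']
  refine Finset.sum_congr rfl fun τ _ => ?_
  have hsign : ((Perm.sign σ : ℤ) : R) * ((Perm.sign σ : ℤ) : R) = 1 := by
    rw [← Int.cast_mul, ← Units.val_mul, Int.units_mul_self, Units.val_one, Int.cast_one]
  have hprod : ∏ i, A (σ i) (τ (σ i)) = ∏ i, A i (τ i) :=
    Equiv.prod_comp σ fun i => A i (τ i)
  simp only [coe_mulRight, Perm.sign_mul, Units.val_mul, Int.cast_mul, Perm.mul_apply, hprod,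
    transpose_apply]
  linear_combination ((Perm.sign τ : ℤ) : R) * (∏ i, A i (τ i)) * hsign

/-- For a symmetric matrix `h̃` with `det h̃ = 0` and `ℓ ∈ ℝⁿ`,
`(1/(n−1)!) Σ_{σ₁,σ₂} sgn(σ₁)sgn(σ₂) h̃_{σ₁(1)σ₂(1)}⋯h̃_{σ₁(n−1)σ₂(n−1)}
  ℓ_{σ₁(n)}ℓ_{σ₂(n)} = det(h̃ + ℓℓᵀ)`. -/
theorem bordered_sum_eq_det_add_rank_one
    (n : ℕ) (hn : 2 ≤ n) (ht : Matrix (Fin n) (Fin n) ℝ)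
    (htsymm : ht.IsSymm) (hdet : ht.det = 0) (ℓ : Fin n → ℝ) :
    (1 / (Nat.factorial (n - 1) : ℝ)) *
      ∑ σ₁ : Equiv.Perm (Fin n), ∑ σ₂ : Equiv.Perm (Fin n),
        ((Equiv.Perm.sign σ₁ : ℤ) : ℝ) * ((Equiv.Perm.sign σ₂ : ℤ) : ℝ) *
          ∏ i : Fin n,
            (if (i : ℕ) < n - 1 then ht (σ₁ i) (σ₂ i) else ℓ (σ₁ i) * ℓ (σ₂ i)) =
      (ht + Matrix.of (fun i j => ℓ i * ℓ j)).det := by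
  obtain ⟨m, rfl⟩ : ∃ m, n = m + 1 := ⟨n - 1, by omega⟩
  have hentry : ∀ σ₁ σ₂ : Perm (Fin (m + 1)), ∀ i : Fin (m + 1),
      (if (i : ℕ) < m + 1 - 1 then ht (σ₁ i) (σ₂ i) else ℓ (σ₁ i) * ℓ (σ₂ i)) =
        ht.updateRow (σ₁ (Fin.last m)) (ℓ (σ₁ (Fin.last m)) • ℓ) (σ₁ i) (σ₂ i) := by
    intro σ₁ σ₂ i
    rcases eq_or_ne i (Fin.last m) with rfl | hi
    · simp
    · rw [if_pos (by simpa using Fin.val_lt_last hi), updateRow_ne (σ₁.injective.ne hi)]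
  have hfact : (Nat.factorial m : ℝ) ≠ 0 := by positivity
  simp only [hentry, sum_sign_mul_prod_eq_det]
  rw [Perm.sum_apply_fin m (fun p => (ht.updateRow p (ℓ p • ℓ)).det), Nat.add_sub_cancel,
    one_div, inv_mul_cancel_left₀ hfact]
  change _ = (ht + vecMulVec ℓ ℓ).det
  simp only [det_add_vecMulVec_eq_sum, hdet, zero_add, det_updateRow_smul]
end
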